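/- Let 1 ≤ p < ∞, 0 < q, r < ∞, let u, v, w be weights on (a,b), and let {x_k}_{k=N}^∞ ⊂ [a,b] with N ∈ ℤ be a discretizing sequence of W*(t) = ∫_t^b w. Then there exists a positive constant C such that (∫_a^b (∫_a^x (∫_a^t f)^q u(t) dt)^{r/q} w(x) dx)^{1/r} ≤ C (∫_a^b f^p v)^{1/p} holds for all f ∈ 𝔐⁺(a,b) if and only if there exist positive constants C' and C'' such that both (Σ_{k=N+1}^∞ 2^{-k} (∫_{x_{k-1}}^{x_k} (∫_{x_{k-1}}^t f)^q u(t) dt)^{r/q})^{1/r} ≤ C' (Σ_{k=N+1}^∞ ∫_{x_{k-1}}^{x_k} f^p v)^{1/p} and (Σ_{k=N+1}^∞ 2^{-k} (∫_a^{x_k} f)^r (∫_{x_k}^{x_{k+1}} u)^{r/q})^{1/r} ≤ C'' (Σ_{k=N+1}^∞ ∫_{x_{k-1}}^{x_k} f^p v)^{1/p} hold for all f ∈ 𝔐⁺(a,b). Moreover, the best constants satisfy C ≈ C' + C''. -/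

import Mathlib

open MeasureTheory Set ENNReal

noncomputable section

/-- The open interval `(a, b)` with extended-real endpoints, viewed as a set of reals. -/
def io (a b : EReal) : Set ℝ := {x : ℝ | a < (x : EReal) ∧ (x : EReal) < b}

/-- A weight on `(a, b)`: a measurable function which is positive and finite on `(a, b)`. -/
def IsWeight (a b : EReal) (u : ℝ → ℝ≥0∞) : Prop :=
  Measurable u ∧ ∀ x ∈ io a b, 0 < u x ∧ u x < ⊤

/-- `W*(t) = ∫_t^b w`. -/
def Wstar (b : EReal) (w : ℝ → ℝ≥0∞) (t : ℝ) : ℝ≥0∞ := ∫⁻ s in io t b, w s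

/-- `{x_k}_{k=N}^∞ ⊂ [a, b]` is a discretizing sequence of `W*` with constants
`d₁, d₂`: it is strictly increasing, starts at `a`, and `W*(x_k) ≈ 2 ^ (-k)`. -/
def IsDiscretizing (a b : EReal) (w : ℝ → ℝ≥0∞) (N : ℤ) (x : ℤ → ℝ)
    (d₁ d₂ : ℝ≥0∞) : Prop :=
  (x N : EReal) = a ∧
  (∀ k : ℤ, N ≤ k → x k < x (k + 1)) ∧
  (∀ k : ℤ, N ≤ k → a ≤ (x k : EReal) ∧ (x k : EReal) ≤ b) ∧
  ∀ k : ℤ, N ≤ k →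
    d₁ * (2 : ℝ≥0∞) ^ (-(k : ℝ)) ≤ Wstar b w (x k) ∧
    Wstar b w (x k) ≤ d₂ * (2 : ℝ≥0∞) ^ (-(k : ℝ))

/-- The left-hand side of the iterated Hardy inequality. -/
def lhsIter (a b : EReal) (q r : ℝ) (u w f : ℝ → ℝ≥0∞) : ℝ≥0∞ :=
  (∫⁻ x in io a b,
    (∫⁻ t in io a x, (∫⁻ s in io a t, f s) ^ q * u t) ^ (r / q) * w x) ^ (1 / r)

/-- The right-hand side (without the constant) of the iterated Hardy inequality. -/
def rhsNorm (a b : EReal) (p : ℝ) (v f : ℝ → ℝ≥0∞) : ℝ≥0∞ :=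
  (∫⁻ x in io a b, f x ^ p * v x) ^ (1 / p)

/-- The left-hand side of the first discretized inequality `(3.3)`. -/
def lhsD1 (N : ℤ) (x : ℤ → ℝ) (q r : ℝ) (u f : ℝ → ℝ≥0∞) : ℝ≥0∞ :=
  (∑' j : ℕ, (2 : ℝ≥0∞) ^ (-((N + 1 + j : ℤ) : ℝ)) *
    (∫⁻ t in Ioo (x (N + j)) (x (N + 1 + j)),
      (∫⁻ s in Ioo (x (N + j)) t, f s) ^ q * u t) ^ (r / q)) ^ (1 / r)

/-- The left-hand side of the second discretized inequality `(3.4)`. -/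
def lhsD2 (a : EReal) (N : ℤ) (x : ℤ → ℝ) (q r : ℝ) (u f : ℝ → ℝ≥0∞) : ℝ≥0∞ :=
  (∑' j : ℕ, (2 : ℝ≥0∞) ^ (-((N + 1 + j : ℤ) : ℝ)) *
    (∫⁻ s in io a (x (N + 1 + j)), f s) ^ r *
    (∫⁻ t in Ioo (x (N + 1 + j)) (x (N + 2 + j)), u t) ^ (r / q)) ^ (1 / r)

/-- The right-hand side (without the constant) of the discretized inequalities. -/
def rhsD (N : ℤ) (x : ℤ → ℝ) (p : ℝ) (v f : ℝ → ℝ≥0∞) : ℝ≥0∞ :=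
  (∑' j : ℕ, ∫⁻ t in Ioo (x (N + j)) (x (N + 1 + j)), f t ^ p * v t) ^ (1 / p)

/-- A power of a sum is bounded by the powers of the summands, with a constant `3 / 2` in front
of one of them. -/
lemma exists_add_rpow_le {s : ℝ} (hs : 0 < s) :
    ∃ K : ℝ≥0∞, 1 ≤ K ∧ K < ⊤ ∧ ∀ x y : ℝ≥0∞, (x + y) ^ s ≤ (3 / 2) * x ^ s + K * y ^ s := by
  have h32 : (1 : ℝ≥0∞) < 3 / 2 := by
    rw [ENNReal.lt_div_iff_mul_lt (by simp) (by simp)]; norm_num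
  have h32t : (3 / 2 : ℝ≥0∞) ≠ ⊤ := ENNReal.div_ne_top (by simp) (by simp)
  set c : ℝ≥0∞ := (3 / 2) ^ (1 / s) with hc
  have hc1 : 1 < c := ENNReal.one_lt_rpow h32 (by positivity)
  have hct : c ≠ ⊤ := ENNReal.rpow_ne_top_of_nonneg (by positivity) h32t
  have hcs : c ^ s = 3 / 2 := by
    rw [hc, ← ENNReal.rpow_mul, one_div_mul_cancel hs.ne', ENNReal.rpow_one]
  set δ := c - 1 with hδ
  have hδ0 : δ ≠ 0 := (tsub_pos_of_lt hc1).ne'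
  have hδt : δ ≠ ⊤ := ENNReal.sub_ne_top hct
  have hcδ : c = 1 + δ := (add_tsub_cancel_of_le hc1.le).symm
  refine ⟨(δ⁻¹ + 1) ^ s, ENNReal.one_le_rpow (by simp) hs,
    ENNReal.rpow_lt_top_of_nonneg hs.le (by simp [hδ0]), fun x y ↦ ?_⟩
  rcases le_total y (δ * x) with h | h
  · calc (x + y) ^ s ≤ (c * x) ^ s := by
          gcongr; rw [hcδ, add_mul, one_mul]; gcongr
      _ = 3 / 2 * x ^ s := by rw [ENNReal.mul_rpow_of_nonneg _ _ hs.le, hcs]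
      _ ≤ _ := le_self_add
  · calc (x + y) ^ s ≤ ((δ⁻¹ + 1) * y) ^ s := by
          gcongr; rw [add_mul, one_mul]; gcongr
          rw [← ENNReal.div_eq_inv_mul, ENNReal.le_div_iff_mul_le (.inl hδ0) (.inl hδt), mul_comm]
          exact h
      _ = (δ⁻¹ + 1) ^ s * y ^ s := ENNReal.mul_rpow_of_nonneg _ _ hs.le
      _ ≤ _ := le_add_self

lemma exists_add_rpow_le_mul {s : ℝ} (hs : 0 < s) :
    ∃ K : ℝ≥0∞, K < ⊤ ∧ ∀ x y : ℝ≥0∞, (x + y) ^ s ≤ K * (x ^ s + y ^ s) := by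
  obtain ⟨K, -, hK, h⟩ := exists_add_rpow_le hs
  refine ⟨3 / 2 + K, ENNReal.add_lt_top.2 ⟨ENNReal.div_lt_top (by simp) (by simp), hK⟩, fun x y ↦ ?_⟩
  refine (h x y).trans ?_
  rw [mul_add]
  gcongr
  · exact le_self_add
  · exact le_add_self

/-- Discrete Hardy inequality for geometric weights. -/
lemma exists_tsum_geometric_mul_rpow_sum_le {s : ℝ} (hs : 0 < s) :
    ∃ K : ℝ≥0∞, K < ⊤ ∧ ∀ ω c : ℕ → ℝ≥0∞, (∀ j, ω j = 2 * ω (j + 1)) →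
      ∑' j, ω j * (∑ i ∈ Finset.range (j + 1), c i) ^ s ≤ K * ∑' j, ω j * c j ^ s := by
  obtain ⟨K, h1, hK, h⟩ := exists_add_rpow_le hs
  refine ⟨4 * K, ENNReal.mul_lt_top (by simp) hK, fun ω c hω ↦ ?_⟩
  set S : ℕ → ℝ≥0∞ := fun j ↦ ∑ i ∈ Finset.range (j + 1), c i with hS
  have hstep (j : ℕ) : ω (j + 1) * S (j + 1) ^ s ≤
      (3 / 4) * (ω j * S j ^ s) + K * (ω (j + 1) * c (j + 1) ^ s) := by
    have h34 : (3 / 4 * 2 : ℝ≥0∞) = 3 / 2 := by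
      rw [show (3 / 4 : ℝ≥0∞) = 3 / (2 * 2) by norm_num, ENNReal.div_eq_inv_mul,
        ENNReal.div_eq_inv_mul, ENNReal.mul_inv (by simp) (by simp)]
      calc (2⁻¹ * 2⁻¹ * 3 * 2 : ℝ≥0∞) = 2⁻¹ * 3 * (2⁻¹ * 2) := by ring
        _ = _ := by rw [ENNReal.inv_mul_cancel (by simp) (by simp), mul_one]
    calc ω (j + 1) * S (j + 1) ^ s
        = ω (j + 1) * (S j + c (j + 1)) ^ s := by rw [hS]; simp only [Finset.sum_range_succ]
      _ ≤ ω (j + 1) * ((3 / 2) * S j ^ s + K * c (j + 1) ^ s) := by gcongr; exact h _ _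
      _ = _ := by rw [hω j, ← h34]; ring
  have hfin (n : ℕ) : ∑ j ∈ Finset.range (n + 1), ω j * S j ^ s ≤
      4 * K * ∑ j ∈ Finset.range (n + 1), ω j * c j ^ s := by
    induction n with
    | zero =>
      simp only [hS, zero_add, Finset.sum_range_one]
      refine le_mul_of_one_le_left' (h1.trans ?_)
      exact le_mul_of_one_le_left' (by norm_num)
    | succ n ih =>
      set A := ∑ j ∈ Finset.range (n + 1), ω j * c j ^ s
      set B := ∑ j ∈ Finset.range (n + 1), ω (j + 1) * c (j + 1) ^ s
      have hAA : A ≤ ∑ j ∈ Finset.range (n + 2), ω j * c j ^ s := by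
        rw [Finset.sum_range_succ _ (n + 1)]; exact le_self_add
      have h0A : ω 0 * c 0 ^ s + B = ∑ j ∈ Finset.range (n + 2), ω j * c j ^ s := by
        rw [Finset.sum_range_succ' _ (n + 1), add_comm]
      have h34 : (3 / 4 * (4 * K) : ℝ≥0∞) = 3 * K := by
        rw [← mul_assoc, ENNReal.div_mul_cancel (by simp) (by simp)]
      calc ∑ j ∈ Finset.range (n + 2), ω j * S j ^ s
          = ω 0 * c 0 ^ s + ∑ j ∈ Finset.range (n + 1), ω (j + 1) * S (j + 1) ^ s := by
            rw [Finset.sum_range_succ' _ (n + 1), add_comm]; simp [hS]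
        _ ≤ K * (ω 0 * c 0 ^ s) + ∑ j ∈ Finset.range (n + 1),
              ((3 / 4) * (ω j * S j ^ s) + K * (ω (j + 1) * c (j + 1) ^ s)) := by
            exact add_le_add (le_mul_of_one_le_left' h1) (Finset.sum_le_sum fun j _ ↦ hstep j)
        _ = K * (ω 0 * c 0 ^ s + B) +
              (3 / 4) * ∑ j ∈ Finset.range (n + 1), ω j * S j ^ s := by
            rw [Finset.sum_add_distrib, ← Finset.mul_sum, ← Finset.mul_sum]; ring
        _ ≤ K * (ω 0 * c 0 ^ s + B) + (3 / 4) * (4 * K * A) := by gcongr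
        _ = K * (ω 0 * c 0 ^ s + B) + 3 * K * A := by rw [← mul_assoc, h34]
        _ ≤ K * (∑ j ∈ Finset.range (n + 2), ω j * c j ^ s) +
              3 * K * (∑ j ∈ Finset.range (n + 2), ω j * c j ^ s) := by
            rw [h0A]; gcongr
        _ = _ := by ring
  refine ENNReal.tsum_le_of_sum_range_le fun n ↦ ?_
  calc ∑ j ∈ Finset.range n, ω j * S j ^ s
      ≤ ∑ j ∈ Finset.range (n + 1), ω j * S j ^ s := by
        rw [Finset.sum_range_succ]; exact le_self_add
    _ ≤ _ := hfin n
    _ ≤ _ := by gcongr; exact ENNReal.sum_le_tsum _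

lemma setLIntegral_Ioo_add_Ioo {x y z : ℝ} (hxy : x ≤ y) (hyz : y ≤ z) (g : ℝ → ℝ≥0∞) :
    ∫⁻ t in Ioo x z, g t = (∫⁻ t in Ioo x y, g t) + ∫⁻ t in Ioo y z, g t := by
  simp only [setLIntegral_congr Ioo_ae_eq_Ioc]
  rw [← Ioc_union_Ioc_eq_Ioc hxy hyz,
    lintegral_union measurableSet_Ioc (Ioc_disjoint_Ioc_of_le le_rfl)]

lemma setLIntegral_Ioo_eq_sum {y : ℕ → ℝ} (hy : StrictMono y) (g : ℝ → ℝ≥0∞) (k n : ℕ) :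
    ∫⁻ t in Ioo (y k) (y (k + n)), g t =
      ∑ i ∈ Finset.range n, ∫⁻ t in Ioo (y (k + i)) (y (k + i + 1)), g t := by
  induction n with
  | zero => simp
  | succ n ih =>
    rw [Finset.sum_range_succ, ← ih, ← add_assoc]
    exact setLIntegral_Ioo_add_Ioo (hy.monotone (by lia)) (hy.monotone (by lia)) g

lemma setLIntegral_iUnion_Ioc_eq_tsum {y : ℕ → ℝ} (hy : StrictMono y) (g : ℝ → ℝ≥0∞) :
    ∫⁻ t in ⋃ j, Ioc (y j) (y (j + 1)), g t = ∑' j, ∫⁻ t in Ioo (y j) (y (j + 1)), g t := by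
  have hd : Pairwise (Function.onFun Disjoint fun j ↦ Ioc (y j) (y (j + 1))) :=
    hy.monotone.pairwise_disjoint_on_Ioc_succ
  rw [lintegral_iUnion (fun _ ↦ measurableSet_Ioc) hd]
  simp only [setLIntegral_congr Ioo_ae_eq_Ioc]

lemma io_coe (x y : ℝ) : io x y = Ioo x y := by
  ext t; simp [io]

lemma measurableSet_io (a b : EReal) : MeasurableSet (io a b) :=
  (measurableSet_lt measurable_const measurable_coe_real_ereal).inter
    (measurableSet_lt measurable_coe_real_ereal measurable_const)

/-- Upper bound of a weighted integral of a power of a primitive by a sum over blocks. -/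
lemma exists_lintegral_rpow_primitive_le {s : ℝ} (hs : 0 < s) :
    ∃ K : ℝ≥0∞, K < ⊤ ∧ ∀ (y : ℕ → ℝ), StrictMono y → ∀ ω : ℕ → ℝ≥0∞,
      (∀ j, ω j = 2 * ω (j + 1)) → ∀ w g : ℝ → ℝ≥0∞, Measurable w → ∀ D : ℝ≥0∞,
      (∀ j, ∫⁻ t in Ioo (y j) (y (j + 1)), w t ≤ D * ω j) →
      ∫⁻ x in ⋃ j, Ioc (y j) (y (j + 1)), (∫⁻ t in Ioo (y 0) x, g t) ^ s * w x ≤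
        K * D * ∑' j, ω j * (∫⁻ t in Ioo (y j) (y (j + 1)), g t) ^ s := by
  obtain ⟨K, hK, h⟩ := exists_tsum_geometric_mul_rpow_sum_le hs
  refine ⟨K, hK, fun y hy ω hω w g hw D hD ↦ ?_⟩
  rw [setLIntegral_iUnion_Ioc_eq_tsum hy]
  calc ∑' j, ∫⁻ x in Ioo (y j) (y (j + 1)), (∫⁻ t in Ioo (y 0) x, g t) ^ s * w x
      ≤ ∑' j, (∫⁻ t in Ioo (y 0) (y (j + 1)), g t) ^ s * (D * ω j) := by
        refine ENNReal.tsum_le_tsum fun j ↦ ?_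
        calc ∫⁻ x in Ioo (y j) (y (j + 1)), (∫⁻ t in Ioo (y 0) x, g t) ^ s * w x
            ≤ ∫⁻ x in Ioo (y j) (y (j + 1)),
                (∫⁻ t in Ioo (y 0) (y (j + 1)), g t) ^ s * w x := by
              refine setLIntegral_mono' measurableSet_Ioo fun x hx ↦ ?_
              gcongr
              exact hx.2.le
          _ = (∫⁻ t in Ioo (y 0) (y (j + 1)), g t) ^ s *
                ∫⁻ x in Ioo (y j) (y (j + 1)), w x := lintegral_const_mul _ hw
          _ ≤ _ := by gcongr; exact hD j
    _ = D * ∑' j, ω j *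
          (∑ i ∈ Finset.range (j + 1), ∫⁻ t in Ioo (y i) (y (i + 1)), g t) ^ s := by
        rw [← ENNReal.tsum_mul_left]
        refine tsum_congr fun j ↦ ?_
        have := setLIntegral_Ioo_eq_sum hy g 0 (j + 1)
        simp only [zero_add] at this
        rw [this]; ring
    _ ≤ D * (K * ∑' j, ω j * (∫⁻ t in Ioo (y j) (y (j + 1)), g t) ^ s) := by
        gcongr; exact h _ _ hω
    _ = _ := by ring

/-- Lower bound of a weighted integral of a power of a primitive by a sum over blocks, when the
weight is large enough on every run of `m` blocks. -/
lemma mul_tsum_le_lintegral_rpow_primitive {s : ℝ} (hs : 0 < s) {y : ℕ → ℝ} (hy : StrictMono y)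
    (ω : ℕ → ℝ≥0∞) (w g : ℝ → ℝ≥0∞) (c : ℝ≥0∞) (m : ℕ)
    (hc : ∀ j, c * ω j ≤ ∫⁻ t in Ioo (y (j + 1)) (y (j + 1 + m)), w t) :
    c * ∑' j, ω j * (∫⁻ t in Ioo (y j) (y (j + 1)), g t) ^ s ≤
      m * ∫⁻ x in ⋃ j, Ioc (y j) (y (j + 1)), (∫⁻ t in Ioo (y 0) x, g t) ^ s * w x := by
  rw [setLIntegral_iUnion_Ioc_eq_tsum hy]
  set P : ℕ → ℝ≥0∞ := fun j ↦
    ∫⁻ x in Ioo (y j) (y (j + 1)), (∫⁻ t in Ioo (y 0) x, g t) ^ s * w x with hP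
  calc c * ∑' j, ω j * (∫⁻ t in Ioo (y j) (y (j + 1)), g t) ^ s
      = ∑' j, (∫⁻ t in Ioo (y j) (y (j + 1)), g t) ^ s * (c * ω j) := by
        rw [← ENNReal.tsum_mul_left]
        exact tsum_congr fun j ↦ by ring
    _ ≤ ∑' j, ∑ i ∈ Finset.range m, P (j + 1 + i) := by
        refine ENNReal.tsum_le_tsum fun j ↦ ?_
        rw [hP, ← setLIntegral_Ioo_eq_sum hy
          (fun x ↦ (∫⁻ t in Ioo (y 0) x, g t) ^ s * w x) (j + 1) m]
        calc _ ≤ (∫⁻ t in Ioo (y j) (y (j + 1)), g t) ^ s *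
                ∫⁻ x in Ioo (y (j + 1)) (y (j + 1 + m)), w x := by gcongr; exact hc j
          _ ≤ ∫⁻ x in Ioo (y (j + 1)) (y (j + 1 + m)),
                (∫⁻ t in Ioo (y j) (y (j + 1)), g t) ^ s * w x := lintegral_const_mul_le _ _
          _ ≤ _ := by
              refine setLIntegral_mono' measurableSet_Ioo fun x hx ↦ ?_
              gcongr
              · exact hy.monotone (Nat.zero_le j)
              · exact hx.1.le
    _ = ∑ i ∈ Finset.range m, ∑' j, P (j + 1 + i) :=
        Summable.tsum_finsetSum fun _ _ ↦ ENNReal.summable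
    _ ≤ ∑ i ∈ Finset.range m, ∑' j, P j := by
        refine Finset.sum_le_sum fun i _ ↦ ?_
        exact ENNReal.tsum_comp_le_tsum_of_injective (f := fun j ↦ j + 1 + i)
          (fun j k hjk ↦ by simpa using hjk) P
    _ = _ := by simp

lemma rpow_mul_le_lintegral_rpow_primitive {q : ℝ} (hq : 0 < q) (f u : ℝ → ℝ≥0∞) {x y z : ℝ} :
    (∫⁻ s in Ioo x y, f s) ^ q * ∫⁻ t in Ioo y z, u t ≤
      ∫⁻ t in Ioo y z, (∫⁻ s in Ioo x t, f s) ^ q * u t := by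
  refine (lintegral_const_mul_le _ _).trans (setLIntegral_mono' measurableSet_Ioo fun t ht ↦ ?_)
  gcongr
  exact ht.1.le

/-- Splitting the primitive in each block into its initial value and its increment. -/
lemma exists_tsum_primitive_split {q r : ℝ} (hq : 0 < q) (hr : 0 < r) :
    ∃ K : ℝ≥0∞, K < ⊤ ∧ ∀ (y : ℕ → ℝ), StrictMono y → ∀ ω : ℕ → ℝ≥0∞,
      (∀ j, ω j = 2 * ω (j + 1)) → ∀ f u : ℝ → ℝ≥0∞, Measurable u →
      ∑' j, ω j * (∫⁻ t in Ioo (y j) (y (j + 1)),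
          (∫⁻ s in Ioo (y 0) t, f s) ^ q * u t) ^ (r / q) ≤
        K * ((∑' j, ω j * (∫⁻ t in Ioo (y j) (y (j + 1)),
            (∫⁻ s in Ioo (y j) t, f s) ^ q * u t) ^ (r / q)) +
          ∑' j, ω j * (∫⁻ s in Ioo (y 0) (y (j + 1)), f s) ^ r *
            (∫⁻ t in Ioo (y (j + 1)) (y (j + 2)), u t) ^ (r / q)) := by
  have hs : 0 < r / q := by positivity
  obtain ⟨A, hA, hAq⟩ := exists_add_rpow_le_mul hq
  obtain ⟨B, hB, hBs⟩ := exists_add_rpow_le_mul hs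
  refine ⟨A ^ (r / q) * B,
    ENNReal.mul_lt_top (ENNReal.rpow_lt_top_of_nonneg hs.le hA.ne) hB,
    fun y hy ω hω f u hu ↦ ?_⟩
  set I : ℕ → ℝ≥0∞ := fun j ↦
    ∫⁻ t in Ioo (y j) (y (j + 1)), (∫⁻ s in Ioo (y 0) t, f s) ^ q * u t
  set J : ℕ → ℝ≥0∞ := fun j ↦
    ∫⁻ t in Ioo (y j) (y (j + 1)), (∫⁻ s in Ioo (y j) t, f s) ^ q * u t
  set F : ℕ → ℝ≥0∞ := fun j ↦ ∫⁻ s in Ioo (y 0) (y j), f s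
  set H : ℕ → ℝ≥0∞ := fun j ↦ ∫⁻ t in Ioo (y j) (y (j + 1)), u t
  have hIJ (j : ℕ) : I j ≤ A * (F j ^ q * H j + J j) := by
    calc I j ≤ ∫⁻ t in Ioo (y j) (y (j + 1)),
          A * (F j ^ q * u t + (∫⁻ s in Ioo (y j) t, f s) ^ q * u t) := by
          refine setLIntegral_mono' measurableSet_Ioo fun t ht ↦ ?_
          rw [setLIntegral_Ioo_add_Ioo (hy.monotone (Nat.zero_le j)) ht.1.le, ← add_mul, ← mul_assoc]
          gcongr
          exact hAq _ _
      _ = _ := by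
          rw [lintegral_const_mul' _ _ hA.ne, lintegral_add_left (hu.const_mul _),
            lintegral_const_mul _ hu]
  have hIs (j : ℕ) : ω j * I j ^ (r / q) ≤ A ^ (r / q) * B *
      (ω j * J j ^ (r / q) + ω j * F j ^ r * H j ^ (r / q)) := by
    calc ω j * I j ^ (r / q) ≤ ω j * (A * (F j ^ q * H j + J j)) ^ (r / q) := by
          gcongr; exact hIJ j
      _ ≤ ω j * (A ^ (r / q) * (B * ((F j ^ q * H j) ^ (r / q) + J j ^ (r / q)))) := by
          rw [ENNReal.mul_rpow_of_nonneg _ _ hs.le]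
          gcongr
          exact hBs _ _
      _ = _ := by
          rw [ENNReal.mul_rpow_of_nonneg _ _ hs.le, ← ENNReal.rpow_mul, mul_div_cancel₀ r hq.ne']
          ring
  have hF0 : F 0 = 0 := by simp [F]
  calc ∑' j, ω j * I j ^ (r / q) ≤ ∑' j, A ^ (r / q) * B *
        (ω j * J j ^ (r / q) + ω j * F j ^ r * H j ^ (r / q)) := ENNReal.tsum_le_tsum hIs
    _ = A ^ (r / q) * B * (∑' j, ω j * J j ^ (r / q) +
          ∑' j, ω (j + 1) * F (j + 1) ^ r * H (j + 1) ^ (r / q)) := by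
        rw [ENNReal.tsum_mul_left, ENNReal.tsum_add,
          tsum_eq_zero_add' (f := fun j ↦ ω j * F j ^ r * H j ^ (r / q)) ENNReal.summable,
          hF0, ENNReal.zero_rpow_of_pos hr]
        simp
    _ ≤ _ := by
        gcongr with j
        rw [hω j]
        exact le_mul_of_one_le_left' one_le_two

lemma tsum_increment_le_tsum_primitive {q r : ℝ} (hq : 0 < q) (hr : 0 < r) {y : ℕ → ℝ}
    (hy : StrictMono y) (ω : ℕ → ℝ≥0∞) (f u : ℝ → ℝ≥0∞) :
    ∑' j, ω j * (∫⁻ t in Ioo (y j) (y (j + 1)),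
        (∫⁻ s in Ioo (y j) t, f s) ^ q * u t) ^ (r / q) ≤
      ∑' j, ω j * (∫⁻ t in Ioo (y j) (y (j + 1)),
        (∫⁻ s in Ioo (y 0) t, f s) ^ q * u t) ^ (r / q) := by
  have : 0 ≤ r / q := by positivity
  gcongr with j t
  exact hy.monotone (Nat.zero_le j)

lemma tsum_initial_value_le_tsum_primitive {q r : ℝ} (hq : 0 < q) (hr : 0 < r) {y : ℕ → ℝ}
    {ω : ℕ → ℝ≥0∞} (hω : ∀ j, ω j = 2 * ω (j + 1)) (f u : ℝ → ℝ≥0∞) :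
    ∑' j, ω j * (∫⁻ s in Ioo (y 0) (y (j + 1)), f s) ^ r *
        (∫⁻ t in Ioo (y (j + 1)) (y (j + 2)), u t) ^ (r / q) ≤
      2 * ∑' j, ω j * (∫⁻ t in Ioo (y j) (y (j + 1)),
        (∫⁻ s in Ioo (y 0) t, f s) ^ q * u t) ^ (r / q) := by
  have hs : 0 ≤ r / q := by positivity
  calc _ ≤ ∑' j, 2 * (ω (j + 1) * (∫⁻ t in Ioo (y (j + 1)) (y (j + 1 + 1)),
        (∫⁻ s in Ioo (y 0) t, f s) ^ q * u t) ^ (r / q)) := by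
        refine ENNReal.tsum_le_tsum fun j ↦ ?_
        rw [hω j, ← mul_assoc, mul_assoc]
        refine mul_le_mul_right ?_ _
        calc _ = ((∫⁻ s in Ioo (y 0) (y (j + 1)), f s) ^ q *
              ∫⁻ t in Ioo (y (j + 1)) (y (j + 2)), u t) ^ (r / q) := by
              rw [ENNReal.mul_rpow_of_nonneg _ _ hs, ← ENNReal.rpow_mul, mul_div_cancel₀ r hq.ne']
          _ ≤ _ := by gcongr; exact rpow_mul_le_lintegral_rpow_primitive hq f u
    _ ≤ _ := by
        rw [ENNReal.tsum_mul_left]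
        refine mul_le_mul_right ?_ _
        exact ENNReal.tsum_comp_le_tsum_of_injective (add_left_injective 1)
          (fun j ↦ ω j * (∫⁻ t in Ioo (y j) (y (j + 1)),
            (∫⁻ s in Ioo (y 0) t, f s) ^ q * u t) ^ (r / q))

lemma two_rpow_neg_succ (k : ℤ) :
    (2 : ℝ≥0∞) ^ (-(k : ℝ)) = 2 * (2 : ℝ≥0∞) ^ (-((k + 1 : ℤ) : ℝ)) := by
  nth_rewrite 2 [← ENNReal.rpow_one 2]
  rw [← ENNReal.rpow_add _ _ (by simp) (by simp)]
  push_cast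
  ring_nf

lemma inv_two_pow_mul_two_rpow_neg (k : ℤ) (m : ℕ) :
    (2 : ℝ≥0∞) ^ (-((k + m : ℤ) : ℝ)) = 2⁻¹ ^ m * (2 : ℝ≥0∞) ^ (-(k : ℝ)) := by
  rw [← ENNReal.rpow_natCast, ENNReal.inv_rpow, ← ENNReal.rpow_neg,
    ← ENNReal.rpow_add _ _ (by simp) (by simp)]
  push_cast
  ring_nf

lemma io_eq_Ioc_union_io {b : EReal} {x y : ℝ} (hxy : x ≤ y) (hyb : (y : EReal) < b) :
    io x b = Ioc x y ∪ io y b := by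
  ext t
  simp only [io, mem_ofPred_eq, mem_union, mem_Ioc, EReal.coe_lt_coe_iff]
  constructor
  · rintro ⟨h1, h2⟩
    rcases le_or_gt t y with h | h
    · exact .inl ⟨h1, h⟩
    · exact .inr ⟨h, h2⟩
  · rintro (⟨h1, h2⟩ | ⟨h1, h2⟩)
    · exact ⟨h1, (EReal.coe_le_coe_iff.2 h2).trans_lt hyb⟩
    · exact ⟨hxy.trans_lt h1, h2⟩

lemma Wstar_eq_add {b : EReal} {x y : ℝ} (w : ℝ → ℝ≥0∞) (hxy : x ≤ y) (hyb : (y : EReal) < b) :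
    Wstar b w x = (∫⁻ t in Ioo x y, w t) + Wstar b w y := by
  rw [Wstar, io_eq_Ioc_union_io hxy hyb, lintegral_union (measurableSet_io _ _),
    setLIntegral_congr Ioo_ae_eq_Ioc, Wstar]
  refine Set.disjoint_left.2 fun t ht ht' ↦ ?_
  exact absurd (EReal.coe_lt_coe_iff.1 ht'.1) ht.2.not_gt

lemma Wstar_pos {a b : EReal} {w : ℝ → ℝ≥0∞} (hw : IsWeight a b w) {t : ℝ} (ha : a ≤ t)
    (hb : (t : EReal) < b) : 0 < Wstar b w t := by
  obtain ⟨z, htz, hzb⟩ := EReal.lt_iff_exists_real_btwn.1 hb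
  rw [Wstar, setLIntegral_pos_iff hw.1]
  have hsub : Ioo t z ⊆ Function.support w ∩ io t b := fun s hs ↦ by
    have h1 : (t : EReal) < s := EReal.coe_lt_coe_iff.2 hs.1
    have h2 : (s : EReal) < b := (EReal.coe_lt_coe_iff.2 hs.2).trans hzb
    exact ⟨(hw.2 s ⟨ha.trans_lt h1, h2⟩).1.ne', h1, h2⟩
  refine lt_of_lt_of_le ?_ (measure_mono hsub)
  simpa using EReal.coe_lt_coe_iff.1 htz

namespace IsDiscretizing

variable {a b : EReal} {w : ℝ → ℝ≥0∞} {N : ℤ} {x : ℤ → ℝ} {d₁ d₂ : ℝ≥0∞}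

lemma strictMono (h : IsDiscretizing a b w N x d₁ d₂) : StrictMono fun j : ℕ ↦ x (N + j) := by
  refine strictMono_nat_of_lt_succ fun j ↦ ?_
  have := h.2.1 (N + j) (by lia)
  rwa [show N + ((j + 1 : ℕ) : ℤ) = N + j + 1 by push_cast; ring]

lemma lt_right (h : IsDiscretizing a b w N x d₁ d₂) (j : ℕ) : (x (N + j) : EReal) < b :=
  (EReal.coe_lt_coe_iff.2 (h.2.1 (N + j) (by lia))).trans_le (h.2.2.1 (N + j + 1) (by lia)).2

lemma iUnion_Ioc (h : IsDiscretizing a b w N x d₁ d₂) (hw : IsWeight a b w) (hd₂ : d₂ < ⊤) :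
    io a b = ⋃ j : ℕ, Ioc (x (N + j)) (x (N + (j + 1 : ℕ))) := by
  ext t
  simp only [mem_iUnion]
  constructor
  · rintro ⟨hat, htb⟩
    have hex : ∃ j : ℕ, t ≤ x (N + j) := by
      by_contra! hcon
      have hle (j : ℕ) : Wstar b w t ≤ 2⁻¹ ^ j * (2 ^ (-(N : ℝ)) * d₂) := by
        calc Wstar b w t ≤ Wstar b w (x (N + j)) := by
              rw [Wstar_eq_add w (hcon j).le htb]; exact le_add_self
          _ ≤ d₂ * 2 ^ (-((N + j : ℤ) : ℝ)) := (h.2.2.2 _ (by lia)).2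
          _ = _ := by rw [inv_two_pow_mul_two_rpow_neg]; ring
      have hlim : Filter.Tendsto (fun j : ℕ ↦ (2⁻¹ : ℝ≥0∞) ^ j * (2 ^ (-(N : ℝ)) * d₂))
          Filter.atTop (nhds (0 * (2 ^ (-(N : ℝ)) * d₂))) := by
        refine ENNReal.Tendsto.mul_const
          (ENNReal.tendsto_pow_atTop_nhds_zero_of_lt_one (by simp)) (.inr ?_)
        exact ENNReal.mul_ne_top (ENNReal.rpow_ne_top_of_ne_zero (by simp) (by simp)) hd₂.ne
      rw [zero_mul] at hlim
      exact (Wstar_pos hw hat.le htb).not_ge (ge_of_tendsto' hlim hle)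
    classical
    have hfind := Nat.find_spec hex
    obtain ⟨k, hk⟩ : ∃ k, Nat.find hex = k + 1 := by
      refine Nat.exists_eq_succ_of_ne_zero fun h0 ↦ ?_
      rw [h0] at hfind
      rw [← h.1] at hat
      simp only [Nat.cast_zero, add_zero] at hfind
      exact (EReal.coe_lt_coe_iff.1 hat).not_ge hfind
    refine ⟨k, ?_, hk ▸ hfind⟩
    exact not_le.1 (Nat.find_min hex (m := k) (by lia))
  · rintro ⟨j, h1, h2⟩
    exact ⟨(h.2.2.1 (N + j) (by lia)).1.trans_lt (EReal.coe_lt_coe_iff.2 h1),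
      (EReal.coe_le_coe_iff.2 h2).trans_lt (h.lt_right _)⟩

lemma lintegral_Ioo_le (h : IsDiscretizing a b w N x d₁ d₂) (j : ℕ) :
    ∫⁻ t in Ioo (x (N + j)) (x (N + (j + 1 : ℕ))), w t ≤
      2 * d₂ * 2 ^ (-((N + 1 + j : ℤ) : ℝ)) := by
  calc _ ≤ Wstar b w (x (N + j)) := by
        rw [Wstar_eq_add w (h.strictMono j.lt_succ_self).le (h.lt_right (j + 1))]
        exact le_self_add
    _ ≤ d₂ * 2 ^ (-((N + j : ℤ) : ℝ)) := (h.2.2.2 _ (by lia)).2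
    _ = _ := by rw [two_rpow_neg_succ, add_right_comm]; ring

lemma le_lintegral_Ioo (h : IsDiscretizing a b w N x d₁ d₂) {c : ℝ≥0∞} (hc : c ≠ ⊤)
    (hcd : c + c ≤ d₁) {m : ℕ} (hm : d₂ * 2⁻¹ ^ m ≤ c) (j : ℕ) :
    c * 2 ^ (-((N + 1 + j : ℤ) : ℝ)) ≤
      ∫⁻ t in Ioo (x (N + (j + 1 : ℕ))) (x (N + (j + 1 + m : ℕ))), w t := by
  set ω : ℝ≥0∞ := 2 ^ (-((N + 1 + j : ℤ) : ℝ)) with hω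
  have hωt : ω ≠ ⊤ := ENNReal.rpow_ne_top_of_ne_zero (by simp) (by simp)
  have hlow : d₁ * ω ≤ Wstar b w (x (N + (j + 1 : ℕ))) := by
    have := (h.2.2.2 (N + (j + 1 : ℕ)) (by lia)).1
    rwa [show N + ((j + 1 : ℕ) : ℤ) = N + 1 + j by push_cast; ring] at this ⊢
  have hup : Wstar b w (x (N + (j + 1 + m : ℕ))) ≤ c * ω := by
    refine (h.2.2.2 _ (by lia)).2.trans ?_
    rw [show N + ((j + 1 + m : ℕ) : ℤ) = N + 1 + j + m by push_cast; ring,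
      inv_two_pow_mul_two_rpow_neg, ← mul_assoc]
    gcongr
  have hsplit := Wstar_eq_add w (h.strictMono.monotone (show j + 1 ≤ j + 1 + m by lia))
    (h.lt_right (j + 1 + m))
  refine (ENNReal.add_le_add_iff_right (ENNReal.mul_ne_top hc hωt)).1 ?_
  calc c * ω + c * ω = (c + c) * ω := by ring
    _ ≤ d₁ * ω := by gcongr
    _ ≤ _ := hlow
    _ = _ := hsplit
    _ ≤ _ := by gcongr

lemma rhsD_eq (h : IsDiscretizing a b w N x d₁ d₂) (hw : IsWeight a b w) (hd₂ : d₂ < ⊤) (p : ℝ)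
    (v f : ℝ → ℝ≥0∞) : rhsD N x p v f = rhsNorm a b p v f := by
  rw [rhsD, rhsNorm, h.iUnion_Ioc hw hd₂, setLIntegral_iUnion_Ioc_eq_tsum h.strictMono]
  simp only [Nat.cast_add, Nat.cast_one, add_right_comm N 1, add_assoc]

end IsDiscretizing

lemma exists_lhs_equiv {q r : ℝ} (hq : 0 < q) (hr : 0 < r) {d₁ d₂ : ℝ≥0∞} (hd₁ : 0 < d₁)
    (hd₂ : d₂ < ⊤) :
    ∃ K : ℝ≥0∞, 0 < K ∧ K < ⊤ ∧ ∀ (a b : EReal) (u w : ℝ → ℝ≥0∞), IsWeight a b u →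
      IsWeight a b w → ∀ (N : ℤ) (x : ℤ → ℝ), IsDiscretizing a b w N x d₁ d₂ →
      ∀ f : ℝ → ℝ≥0∞, lhsD1 N x q r u f ≤ K * lhsIter a b q r u w f ∧
        lhsD2 a N x q r u f ≤ K * lhsIter a b q r u w f ∧
        lhsIter a b q r u w f ≤ K * (lhsD1 N x q r u f + lhsD2 a N x q r u f) := by
  have hs : 0 < r / q := by positivity
  have hr' : 0 < 1 / r := by positivity
  obtain ⟨A, hA, hAle⟩ := exists_lintegral_rpow_primitive_le hs
  obtain ⟨B, hB, hBle⟩ := exists_tsum_primitive_split hq hr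
  obtain ⟨M, hM, hMle⟩ := exists_add_rpow_le_mul hr'
  obtain ⟨c, hc0, hct, hcd⟩ : ∃ c : ℝ≥0∞, c ≠ 0 ∧ c ≠ ⊤ ∧ c + c ≤ d₁ := by
    refine ⟨min d₁ 1 / 2, ?_, ?_, ?_⟩
    · simp [hd₁.ne']
    · exact ENNReal.div_ne_top (by simp) (by simp)
    · rw [ENNReal.add_halves]; exact min_le_left _ _
  obtain ⟨m, hm⟩ : ∃ m : ℕ, d₂ * 2⁻¹ ^ m ≤ c := by
    obtain ⟨m, hm⟩ := ENNReal.exists_inv_two_pow_lt (ENNReal.div_pos hc0 hd₂.ne).ne'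
    exact ⟨m, ENNReal.mul_le_of_le_div' hm.le⟩
  set K₁ : ℝ≥0∞ := 2 * (c⁻¹ * m) with hK₁
  have hK₁t : K₁ ≠ ⊤ := by simp [hK₁, ENNReal.mul_eq_top, hc0]
  set K₂ : ℝ≥0∞ := A * (2 * d₂) * B with hK₂
  have hK₂t : K₂ ≠ ⊤ := by
    simp [hK₂, ENNReal.mul_eq_top, hA.ne, hB.ne, hd₂.ne]
  refine ⟨1 + K₁ ^ (1 / r) + K₂ ^ (1 / r) * M, by positivity, ?_, ?_⟩
  · have h1 := (ENNReal.rpow_lt_top_of_nonneg hr'.le hK₁t).ne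
    have h2 := (ENNReal.rpow_lt_top_of_nonneg hr'.le hK₂t).ne
    exact (ENNReal.add_ne_top.2 ⟨ENNReal.add_ne_top.2 ⟨by simp, h1⟩, ENNReal.mul_ne_top h2 hM.ne⟩).lt_top
  intro a b u w hu hw N x h f
  set y : ℕ → ℝ := fun j ↦ x (N + j) with hy
  set ω : ℕ → ℝ≥0∞ := fun j ↦ 2 ^ (-((N + 1 + j : ℤ) : ℝ)) with hω
  have hω2 (j : ℕ) : ω j = 2 * ω (j + 1) := by
    simp only [hω]
    rw [two_rpow_neg_succ]; push_cast; ring_nf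
  have hys : StrictMono y := h.strictMono
  have hxy1 (j : ℕ) : x (N + 1 + j) = y (j + 1) := by simp only [hy]; congr 1; push_cast; ring
  have hxy2 (j : ℕ) : x (N + 2 + j) = y (j + 2) := by simp only [hy]; congr 1; push_cast; ring
  have ha : a = (y 0 : EReal) := by simp [hy, h.1]
  set L := ∫⁻ x in ⋃ j, Ioc (y j) (y (j + 1)),
    (∫⁻ t in Ioo (y 0) x, (∫⁻ s in Ioo (y 0) t, f s) ^ q * u t) ^ (r / q) * w x with hL
  set S := ∑' j, ω j * (∫⁻ t in Ioo (y j) (y (j + 1)),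
    (∫⁻ s in Ioo (y 0) t, f s) ^ q * u t) ^ (r / q) with hS
  set S₁ := ∑' j, ω j * (∫⁻ t in Ioo (y j) (y (j + 1)),
    (∫⁻ s in Ioo (y j) t, f s) ^ q * u t) ^ (r / q) with hS₁
  set S₂ := ∑' j, ω j * (∫⁻ s in Ioo (y 0) (y (j + 1)), f s) ^ r *
    (∫⁻ t in Ioo (y (j + 1)) (y (j + 2)), u t) ^ (r / q) with hS₂
  have eL : lhsIter a b q r u w f = L ^ (1 / r) := by
    rw [lhsIter, h.iUnion_Ioc hw hd₂, ha]
    simp only [io_coe, hL, hy]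
  have e₁ : lhsD1 N x q r u f = S₁ ^ (1 / r) := by
    simp only [lhsD1, hxy1, hS₁, hω, hy]
  have e₂ : lhsD2 a N x q r u f = S₂ ^ (1 / r) := by
    simp only [lhsD2, hxy1, hxy2, ha, io_coe, hS₂, hω]
  have hSL : S ≤ c⁻¹ * m * L := by
    have := mul_tsum_le_lintegral_rpow_primitive hs hys ω w
      (fun t ↦ (∫⁻ s in Ioo (y 0) t, f s) ^ q * u t) c m (h.le_lintegral_Ioo hct hcd hm)
    calc S = c⁻¹ * (c * S) := by rw [← mul_assoc, ENNReal.inv_mul_cancel hc0 hct, one_mul]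
      _ ≤ c⁻¹ * (m * L) := by gcongr
      _ = _ := by ring
  have hS₁L : S₁ ≤ K₁ * L := by
    refine (tsum_increment_le_tsum_primitive hq hr hys ω f u).trans (hSL.trans ?_)
    rw [hK₁, mul_assoc 2]
    exact le_mul_of_one_le_left' one_le_two
  have hS₂L : S₂ ≤ K₁ * L := by
    refine (tsum_initial_value_le_tsum_primitive hq hr hω2 f u).trans ?_
    rw [hK₁, mul_assoc 2]
    gcongr
  have hLS : L ≤ K₂ * (S₁ + S₂) := by
    refine (hAle y hys ω hω2 w _ hw.1 (2 * d₂) h.lintegral_Ioo_le).trans ?_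
    rw [hK₂, mul_assoc _ B]
    gcongr
    exact hBle y hys ω hω2 f u hu.1
  have hroot {T : ℝ≥0∞} (hT : T ≤ K₁ * L) :
      T ^ (1 / r) ≤ (1 + K₁ ^ (1 / r) + K₂ ^ (1 / r) * M) * L ^ (1 / r) := by
    calc T ^ (1 / r) ≤ (K₁ * L) ^ (1 / r) := by gcongr
      _ = K₁ ^ (1 / r) * L ^ (1 / r) := ENNReal.mul_rpow_of_nonneg _ _ hr'.le
      _ ≤ _ := by gcongr; exact le_add_self.trans le_self_add
  rw [eL, e₁, e₂]
  refine ⟨hroot hS₁L, hroot hS₂L, ?_⟩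
  calc L ^ (1 / r) ≤ (K₂ * (S₁ + S₂)) ^ (1 / r) := by gcongr
    _ = K₂ ^ (1 / r) * (S₁ + S₂) ^ (1 / r) := ENNReal.mul_rpow_of_nonneg _ _ hr'.le
    _ ≤ K₂ ^ (1 / r) * (M * (S₁ ^ (1 / r) + S₂ ^ (1 / r))) := by gcongr; exact hMle _ _
    _ = K₂ ^ (1 / r) * M * (S₁ ^ (1 / r) + S₂ ^ (1 / r)) := by ring
    _ ≤ _ := by gcongr; exact le_add_self

theorem discretization_of_iterated_hardy (p q r : ℝ) (hp : 1 ≤ p) (hq : 0 < q)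
    (hr : 0 < r) (d₁ d₂ : ℝ≥0∞) (hd₁ : 0 < d₁) (hd₂ : d₂ < ⊤) :
    ∃ c₁ c₂ : ℝ≥0∞, 0 < c₁ ∧ c₂ < ⊤ ∧
      ∀ (a b : EReal), a < b → ∀ u v w : ℝ → ℝ≥0∞,
        IsWeight a b u → IsWeight a b v → IsWeight a b w →
        ∀ (N : ℤ) (x : ℤ → ℝ), IsDiscretizing a b w N x d₁ d₂ →
        ((∃ C : ℝ≥0∞, 0 < C ∧ C < ⊤ ∧ ∀ f : ℝ → ℝ≥0∞, Measurable f →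
            lhsIter a b q r u w f ≤ C * rhsNorm a b p v f) ↔
          (∃ C' C'' : ℝ≥0∞, 0 < C' ∧ C' < ⊤ ∧ 0 < C'' ∧ C'' < ⊤ ∧
            (∀ f : ℝ → ℝ≥0∞, Measurable f →
              lhsD1 N x q r u f ≤ C' * rhsD N x p v f) ∧
            (∀ f : ℝ → ℝ≥0∞, Measurable f →
              lhsD2 a N x q r u f ≤ C'' * rhsD N x p v f))) ∧
        c₁ * (sInf {C' : ℝ≥0∞ | ∀ f : ℝ → ℝ≥0∞, Measurable f →
                lhsD1 N x q r u f ≤ C' * rhsD N x p v f} +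
              sInf {C'' : ℝ≥0∞ | ∀ f : ℝ → ℝ≥0∞, Measurable f →
                lhsD2 a N x q r u f ≤ C'' * rhsD N x p v f}) ≤
            sInf {C : ℝ≥0∞ | ∀ f : ℝ → ℝ≥0∞, Measurable f →
              lhsIter a b q r u w f ≤ C * rhsNorm a b p v f} ∧
        sInf {C : ℝ≥0∞ | ∀ f : ℝ → ℝ≥0∞, Measurable f →
            lhsIter a b q r u w f ≤ C * rhsNorm a b p v f} ≤
          c₂ * (sInf {C' : ℝ≥0∞ | ∀ f : ℝ → ℝ≥0∞, Measurable f →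
                lhsD1 N x q r u f ≤ C' * rhsD N x p v f} +
              sInf {C'' : ℝ≥0∞ | ∀ f : ℝ → ℝ≥0∞, Measurable f →
                lhsD2 a N x q r u f ≤ C'' * rhsD N x p v f}) := by
  obtain ⟨K, hK0, hK, hKle⟩ := exists_lhs_equiv hq hr hd₁ hd₂
  refine ⟨(2 * K)⁻¹, K, by simp [ENNReal.mul_eq_top, hK.ne], hK, ?_⟩
  intro a b _ u v w hu _ hw N x h
  have hrhs (f : ℝ → ℝ≥0∞) : rhsD N x p v f = rhsNorm a b p v f := h.rhsD_eq hw hd₂ p v f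
  simp only [hrhs]
  have hle := hKle a b u w hu hw N x h
  have hfwd {C : ℝ≥0∞}
      (hC : ∀ f : ℝ → ℝ≥0∞, Measurable f → lhsIter a b q r u w f ≤ C * rhsNorm a b p v f) :
      (∀ f : ℝ → ℝ≥0∞, Measurable f → lhsD1 N x q r u f ≤ K * C * rhsNorm a b p v f) ∧
      ∀ f : ℝ → ℝ≥0∞, Measurable f → lhsD2 a N x q r u f ≤ K * C * rhsNorm a b p v f := by
    constructor <;> intro f hf <;> rw [mul_assoc]
    · exact (hle f).1.trans (by gcongr; exact hC f hf)
    · exact (hle f).2.1.trans (by gcongr; exact hC f hf)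
  have hbwd {C' C'' : ℝ≥0∞}
      (h' : ∀ f : ℝ → ℝ≥0∞, Measurable f → lhsD1 N x q r u f ≤ C' * rhsNorm a b p v f)
      (h'' : ∀ f : ℝ → ℝ≥0∞, Measurable f → lhsD2 a N x q r u f ≤ C'' * rhsNorm a b p v f) :
      ∀ f : ℝ → ℝ≥0∞, Measurable f →
        lhsIter a b q r u w f ≤ K * (C' + C'') * rhsNorm a b p v f := by
    intro f hf
    refine (hle f).2.2.trans ?_
    rw [mul_assoc, add_mul]
    gcongr
    · exact h' f hf
    · exact h'' f hf
  refine ⟨⟨?_, ?_⟩, ?_, ?_⟩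
  · rintro ⟨C, hC0, hCt, hC⟩
    have h0 : 0 < K * C := ENNReal.mul_pos hK0.ne' hC0.ne'
    have ht : K * C < ⊤ := ENNReal.mul_lt_top hK hCt
    exact ⟨K * C, K * C, h0, ht, h0, ht, hfwd hC⟩
  · rintro ⟨C', C'', h0', ht', h0'', ht'', h', h''⟩
    exact ⟨K * (C' + C''), ENNReal.mul_pos hK0.ne' (by simp [h0'.ne']),
      ENNReal.mul_lt_top hK (ENNReal.add_lt_top.2 ⟨ht', ht''⟩), hbwd h' h''⟩
  · refine le_sInf fun C hC ↦ ?_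
    obtain ⟨h', h''⟩ := hfwd hC
    calc _ ≤ (2 * K)⁻¹ * (K * C + K * C) := by
          gcongr
          · exact sInf_le h'
          · exact sInf_le h''
      _ = (2 * K)⁻¹ * (2 * K) * C := by ring
      _ = C := by
          rw [ENNReal.inv_mul_cancel (mul_ne_zero two_ne_zero hK0.ne')
            (ENNReal.mul_ne_top (by simp) hK.ne), one_mul]
  · conv_rhs => rw [sInf_eq_iInf', sInf_eq_iInf', ENNReal.iInf_add,
      ENNReal.mul_iInf_of_ne hK0.ne' hK.ne]
    refine le_iInf fun C' ↦ ?_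
    rw [ENNReal.add_iInf, ENNReal.mul_iInf_of_ne hK0.ne' hK.ne]
    exact le_iInf fun C'' ↦ sInf_le (hbwd C'.2 C''.2)
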